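/- Let r ≥ 1, let S ⊆ ℤ^r be finite and let a : S → ℂ. Assume that (ℂ*)^r \ Z(p_a) contains no coset of a one-dimensional subtorus. Then every holomorphic map f = (f_1, …, f_r) : ℂ → ℂ^r such that f_i(ζ) ≠ 0 for all ζ ∈ ℂ and all i, and p_a(f(ζ)) ≠ 0 for all ζ ∈ ℂ, is constant. -/

import Mathlib

open scoped BigOperators

noncomputable section

/-- The Laurent monomial `z^I = ∏ i, z i ^ (I i)` with integer exponents. -/
def lmon {r : ℕ} (z : Fin r → ℂ) (I : Fin r → ℤ) : ℂ :=
  ∏ i, z i ^ (I i)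

/-- The Laurent polynomial `p_a(z) = Σ_{I ∈ S} a(I) z^I`. -/
def pa {r : ℕ} (S : Finset (Fin r → ℤ)) (a : (Fin r → ℤ) → ℂ) (z : Fin r → ℂ) : ℂ :=
  ∑ I ∈ S, a I * lmon z I

/-- The algebraic torus `(ℂ*)^r`, as a subset of `ℂ^r`. -/
def torus (r : ℕ) : Set (Fin r → ℂ) := {z | ∀ i, z i ≠ 0}

/-- The zero set `Z(p_a) = {z ∈ (ℂ*)^r : p_a(z) = 0}`. -/
def Zset {r : ℕ} (S : Finset (Fin r → ℤ)) (a : (Fin r → ℤ) → ℂ) : Set (Fin r → ℂ) :=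
  {z | (∀ i, z i ≠ 0) ∧ pa S a z = 0}

/-- The coset `C(c,v) = {(c_1 t^{v_1}, …, c_r t^{v_r}) : t ∈ ℂ*}` of a
one-dimensional subtorus (for `c ∈ (ℂ*)^r` and `v ∈ ℤ^r` nonzero). -/
def coset {r : ℕ} (c : Fin r → ℂ) (v : Fin r → ℤ) : Set (Fin r → ℂ) :=
  {z | ∃ t : ℂ, t ≠ 0 ∧ z = fun i => c i * t ^ (v i)}

/-- The grouped coefficient `Q_{a,v,d}(c) = Σ_{I ∈ S, ⟨I,v⟩ = d} a(I) c^I`. -/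
def Qc {r : ℕ} (S : Finset (Fin r → ℤ)) (a : (Fin r → ℤ) → ℂ) (v : Fin r → ℤ)
    (d : ℤ) (c : Fin r → ℂ) : ℂ :=
  ∑ I ∈ S.filter (fun I => (∑ i, I i * v i) = d), a I * lmon c I

/-! ### Entire functions as an integral domain -/

theorem eq_zero_or_eq_zero_of_entire_mul_eq_zero {u v : ℂ → ℂ} (hu : Differentiable ℂ u)
    (hv : Differentiable ℂ v) (huv : ∀ z, u z * v z = 0) : u = 0 ∨ v = 0 := by
  have := AnalyticOnNhd.eq_zero_or_eq_zero_of_mul_eq_zero (U := Set.univ)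
    (fun z _ => hu.analyticAt z) (fun z _ => hv.analyticAt z) (fun z _ => huv z)
    isPreconnected_univ
  exact this.imp (fun h => funext fun z => h z trivial) (fun h => funext fun z => h z trivial)

/-- Two entire functions with vanishing Wronskian are proportional. -/
theorem exists_eq_const_mul_of_wronskian_eq_zero {u v : ℂ → ℂ} (hu : Differentiable ℂ u)
    (hv : Differentiable ℂ v) (hv0 : v ≠ 0) (hw : ∀ z, v z * deriv u z = u z * deriv v z) :
    ∃ c : ℂ, ∀ z, u z = c * v z := by
  obtain ⟨z₀, hz₀⟩ := Function.ne_iff.mp hv0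
  obtain ⟨ε, hε, hball⟩ := Metric.eventually_nhds_iff_ball.mp
    (hv.continuous.continuousAt.eventually_ne hz₀ (x := z₀))
  have hquot : ∀ z ∈ Metric.ball z₀ ε, HasDerivAt (fun x => u x / v x) 0 z := by
    intro z hz
    have h := (hu z).hasDerivAt.fun_div (hv z).hasDerivAt (hball z hz)
    rwa [mul_comm (deriv u z), hw, sub_self, zero_div] at h
  refine ⟨u z₀ / v z₀, fun z => ?_⟩
  have hloc : ∀ z ∈ Metric.ball z₀ ε, u z = u z₀ / v z₀ * v z := by
    intro z hz
    have := Metric.isOpen_ball.is_const_of_deriv_eq_zero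
      (convex_ball z₀ ε).isPreconnected
      (fun x hx => (hquot x hx).differentiableAt.differentiableWithinAt)
      (fun x hx => (hquot x hx).deriv) hz (Metric.mem_ball_self hε)
    rw [← this, div_mul_cancel₀ _ (hball z hz)]
  have := AnalyticOnNhd.eq_of_eventuallyEq (𝕜 := ℂ) (z₀ := z₀) (f := u)
    (g := fun z => u z₀ / v z₀ * v z)
    (fun z _ => hu.analyticAt z) (fun z _ => (hv.const_mul _).analyticAt z)
    (Filter.eventually_of_mem (Metric.ball_mem_nhds z₀ hε) hloc)
  exact congrFun this z

/-! ### Exponential relations over a differential algebra of entire functions -/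

/-- `exp ∘ u` and `exp ∘ v` are proportional over the fraction field of `A`. -/
def ExpRelated (A : Subalgebra ℂ (ℂ → ℂ)) (u v : ℂ → ℂ) : Prop :=
  ∃ p ∈ A, ∃ q ∈ A, p ≠ 0 ∧ q ≠ 0 ∧ ∀ z, p z * Complex.exp (u z) = q z * Complex.exp (v z)

section DifferentialAlgebra

variable {A : Subalgebra ℂ (ℂ → ℂ)} {ι : Type*} {g : ι → ℂ → ℂ}

theorem ExpRelated.refl (u : ℂ → ℂ) : ExpRelated A u u :=
  ⟨1, A.one_mem, 1, A.one_mem, one_ne_zero, one_ne_zero, fun _ => rfl⟩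

theorem ExpRelated.symm {u v : ℂ → ℂ} (h : ExpRelated A u v) : ExpRelated A v u := by
  obtain ⟨p, hp, q, hq, hp0, hq0, h⟩ := h
  exact ⟨q, hq, p, hp, hq0, hp0, fun z => (h z).symm⟩

theorem mul_ne_zero_of_mem (hd : ∀ f ∈ A, Differentiable ℂ f) {p q : ℂ → ℂ} (hp : p ∈ A)
    (hq : q ∈ A) (hp0 : p ≠ 0) (hq0 : q ≠ 0) : p * q ≠ 0 := fun h =>
  (eq_zero_or_eq_zero_of_entire_mul_eq_zero (hd p hp) (hd q hq) (congrFun h)).elim hp0 hq0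

theorem ExpRelated.trans (hd : ∀ f ∈ A, Differentiable ℂ f) {u v w : ℂ → ℂ}
    (h₁ : ExpRelated A u v) (h₂ : ExpRelated A v w) : ExpRelated A u w := by
  obtain ⟨p, hp, q, hq, hp0, hq0, h₁⟩ := h₁
  obtain ⟨p', hp', q', hq', hp0', hq0', h₂⟩ := h₂
  refine ⟨p * p', A.mul_mem hp hp', q * q', A.mul_mem hq hq', mul_ne_zero_of_mem hd hp hp' hp0 hp0',
    mul_ne_zero_of_mem hd hq hq' hq0 hq0', fun z => ?_⟩
  simp only [Pi.mul_apply]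
  linear_combination p' z * h₁ z + q z * h₂ z

/-- A nontrivial linear relation between exponentials over `A` forces two of them to be
proportional over the fraction field of `A`. -/
theorem exists_expRelated_of_sum_eq_zero (hd : ∀ f ∈ A, Differentiable ℂ f)
    (hA : ∀ f ∈ A, deriv f ∈ A) (hg : ∀ i, Differentiable ℂ (g i)) (hg' : ∀ i, deriv (g i) ∈ A)
    (t : Finset ι) (ht : t.Nonempty) (b : ι → ℂ → ℂ) (hb : ∀ i ∈ t, b i ∈ A)
    (hb0 : ∀ i ∈ t, b i ≠ 0) (hsum : ∀ z, ∑ i ∈ t, b i z * Complex.exp (g i z) = 0) :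
    ∃ i ∈ t, ∃ k ∈ t, i ≠ k ∧ ExpRelated A (g i) (g k) := by
  classical
  induction t using Finset.strongInduction generalizing b with
  | H t ih =>
  obtain ⟨k, hk⟩ := ht
  let D : ι → ℂ → ℂ := fun i => deriv (b i) + deriv (g i) * b i
  have hD : ∀ i ∈ t, D i ∈ A := fun i hi =>
    A.add_mem (hA _ (hb i hi)) (A.mul_mem (hg' i) (hb i hi))
  have hderiv : ∀ i ∈ t, ∀ z, HasDerivAt (fun z => b i z * Complex.exp (g i z))
      (D i z * Complex.exp (g i z)) z := by
    intro i hi z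
    refine ((hd _ (hb i hi) z).hasDerivAt.fun_mul (hg i z).hasDerivAt.cexp).congr_deriv ?_
    simp only [D, Pi.add_apply, Pi.mul_apply]
    ring
  have hDsum : ∀ z, ∑ i ∈ t, D i z * Complex.exp (g i z) = 0 := by
    intro z
    have h := HasDerivAt.fun_sum (fun i hi => hderiv i hi z)
    rw [funext hsum] at h
    exact h.unique (hasDerivAt_const z 0)
  let c : ι → ℂ → ℂ := fun i => b k * D i - D k * b i
  by_cases hc : ∀ i ∈ t, c i = 0
  · have hexp : ∃ i ∈ t, i ≠ k := by
      by_contra! hne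
      obtain rfl : t = {k} := Finset.eq_singleton_iff_unique_mem.mpr ⟨hk, hne⟩
      refine hb0 k hk (funext fun z => ?_)
      simpa [Complex.exp_ne_zero] using hsum z
    obtain ⟨i, hi, hik⟩ := hexp
    have hdiff : ∀ j ∈ t, Differentiable ℂ (fun z => b j z * Complex.exp (g j z)) :=
      fun j hj z => (hderiv j hj z).differentiableAt
    obtain ⟨z₀, hz₀⟩ := Function.ne_iff.mp (hb0 k hk)
    obtain ⟨l, hl⟩ := exists_eq_const_mul_of_wronskian_eq_zero (hdiff i hi) (hdiff k hk)
      (fun h => hz₀ ((mul_eq_zero.mp (congrFun h z₀)).resolve_right (Complex.exp_ne_zero _)))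
      (fun z => by
        have := congrFun (hc i hi) z
        simp only [c, Pi.sub_apply, Pi.mul_apply, Pi.zero_apply] at this
        rw [(hderiv i hi z).deriv, (hderiv k hk z).deriv]
        linear_combination Complex.exp (g i z) * Complex.exp (g k z) * this)
    have hl0 : l ≠ 0 := by
      rintro rfl
      refine hb0 i hi (funext fun z => ?_)
      simpa [Complex.exp_ne_zero] using hl z
    refine ⟨i, hi, k, hk, hik, b i, hb i hi, l • b k, A.smul_mem (hb k hk) l, hb0 i hi,
      smul_ne_zero hl0 (hb0 k hk), fun z => ?_⟩
    rw [hl z, Pi.smul_apply, smul_eq_mul, mul_assoc]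
  · push Not at hc
    obtain ⟨i, hi, hci⟩ := hc
    have hck : c k = 0 := by simp only [c]; ring
    obtain ⟨i, hi, j, hj, h⟩ := ih (t.filter fun i => c i ≠ 0)
      (Finset.filter_ssubset.mpr ⟨k, hk, by simp [hck]⟩) ⟨i, Finset.mem_filter.mpr ⟨hi, hci⟩⟩ c
      (fun i hi => by
        have hi := (Finset.mem_filter.mp hi).1
        exact A.sub_mem (A.mul_mem (hb k hk) (hD i hi)) (A.mul_mem (hD k hk) (hb i hi)))
      (fun i hi => (Finset.mem_filter.mp hi).2)
      (fun z => by
        rw [Finset.sum_filter_of_ne (p := fun i => c i ≠ 0) fun i _ h hci => h (by simp [hci])]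
        calc ∑ i ∈ t, c i z * Complex.exp (g i z)
            = b k z * ∑ i ∈ t, D i z * Complex.exp (g i z)
              - D k z * ∑ i ∈ t, b i z * Complex.exp (g i z) := by
              simp only [Finset.mul_sum, ← Finset.sum_sub_distrib]
              refine Finset.sum_congr rfl fun i _ => ?_
              simp only [c, Pi.sub_apply, Pi.mul_apply]
              ring
          _ = 0 := by rw [hDsum, hsum]; simp)
    exact ⟨i, (Finset.mem_filter.mp hi).1, j, (Finset.mem_filter.mp hj).1, h⟩

/-- If no proper nonempty subsum of a vanishing sum of exponentials vanishes, then all the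
exponentials are proportional over the fraction field of `A`. -/
theorem expRelated_of_minimal_sum_eq_zero [Fintype ι] (hd : ∀ f ∈ A, Differentiable ℂ f)
    (hA : ∀ f ∈ A, deriv f ∈ A) (hg : ∀ i, Differentiable ℂ (g i)) (hg' : ∀ i, deriv (g i) ∈ A)
    (c : ι → ℂ) (hsum : ∀ z, ∑ i, c i * Complex.exp (g i z) = 0)
    (hmin : ∀ t : Finset ι, t.Nonempty → (∀ z, ∑ i ∈ t, c i * Complex.exp (g i z) = 0) →
      t = Finset.univ) (i k : ι) : ExpRelated A (g i) (g k) := by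
  classical
  let S : Setoid ι := ⟨fun i k => ExpRelated A (g i) (g k),
    fun i => .refl _, fun h => h.symm, fun h₁ h₂ => h₁.trans hd h₂⟩
  let ρ : ι → ι := fun i => (⟦i⟧ : Quotient S).out
  have hρ : ∀ i, ExpRelated A (g i) (g (ρ i)) := fun i => (Quotient.mk_out (s := S) i).symm
  choose p hp q hq hp0 _ hpq using hρ
  have hP : ∏ i, p i ≠ 0 := by
    refine (Finset.prod_induction p (fun f => f ∈ A ∧ f ≠ 0)
      (fun f f' h h' => ⟨A.mul_mem h.1 h'.1, mul_ne_zero_of_mem hd h.1 h'.1 h.2 h'.2⟩)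
      ⟨A.one_mem, one_ne_zero⟩ fun i _ => ⟨hp i, hp0 i⟩).2
  let B : ι → ℂ → ℂ := fun τ =>
    ∑ i with ρ i = τ, c i • ((∏ j ∈ Finset.univ.erase i, p j) * q i)
  have hB : ∀ τ, B τ ∈ A := fun τ => A.sum_mem fun i _ =>
    A.smul_mem (A.mul_mem (A.prod_mem fun j _ => hp j) (hq i)) _
  have hBexp : ∀ τ z, B τ z * Complex.exp (g τ z) =
      (∏ i, p i) z * ∑ i with ρ i = τ, c i * Complex.exp (g i z) := by
    intro τ z
    simp only [B, Finset.sum_apply, Finset.sum_mul, Finset.mul_sum]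
    refine Finset.sum_congr rfl fun i hi => ?_
    have hτ := (Finset.mem_filter.mp hi).2
    have h := hpq i z
    rw [hτ] at h
    rw [← Finset.mul_prod_erase _ _ (Finset.mem_univ i)]
    simp only [Pi.smul_apply, Pi.mul_apply, smul_eq_mul]
    linear_combination -(c i * (∏ j ∈ Finset.univ.erase i, p j) z) * h
  have hBzero : ∀ τ, B τ = 0 := by
    by_contra! hne
    obtain ⟨τ, hτ⟩ := hne
    obtain ⟨σ, hσ, σ', hσ', hne, hrel⟩ := exists_expRelated_of_sum_eq_zero hd hA hg hg'
      (Finset.univ.filter fun τ => B τ ≠ 0) ⟨τ, by simpa using hτ⟩ B (fun i _ => hB i)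
      (fun i hi => (Finset.mem_filter.mp hi).2) (fun z => by
        rw [Finset.sum_filter_of_ne (p := fun τ => B τ ≠ 0) fun τ _ h hτ => h (by simp [hτ])]
        simp only [hBexp, ← Finset.mul_sum]
        rw [Finset.sum_fiberwise Finset.univ ρ fun i => c i * Complex.exp (g i z), hsum, mul_zero])
    have hrep : ∀ σ, B σ ≠ 0 → ρ σ = σ := by
      intro σ hσ
      obtain ⟨i, hi, -⟩ := Finset.exists_ne_zero_of_sum_ne_zero hσ
      obtain rfl := (Finset.mem_filter.mp hi).2
      simp only [ρ, Quotient.out_eq]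
    refine hne ?_
    rw [← hrep σ (Finset.mem_filter.mp hσ).2, ← hrep σ' (Finset.mem_filter.mp hσ').2]
    exact congrArg Quotient.out (Quotient.sound (s := S) hrel)
  have hclass : (Finset.univ.filter fun j => ρ j = ρ i) = Finset.univ := by
    refine hmin _ ⟨i, by simp⟩ fun z => ?_
    have hdsum : Differentiable ℂ
        (fun z => ∑ j with ρ j = ρ i, c j * Complex.exp (g j z)) := by
      refine Differentiable.fun_sum fun j _ => ?_
      have := hg j
      fun_prop
    have hPA : ∏ i, p i ∈ A := A.prod_mem fun i _ => hp i
    refine congrFun ((eq_zero_or_eq_zero_of_entire_mul_eq_zero (hd _ hPA) hdsum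
      fun z => ?_).resolve_left hP) z
    rw [← hBexp, hBzero]
    simp
  have hk : ρ k = ρ i := (Finset.mem_filter.mp (hclass.symm ▸ Finset.mem_univ k :
    k ∈ Finset.univ.filter fun j => ρ j = ρ i)).2
  have h₁ := Quotient.mk_out (s := S) i
  have h₂ := Quotient.mk_out (s := S) k
  exact h₁.symm.trans hd (show ExpRelated A (g (ρ i)) (g k) from hk ▸ h₂)

end DifferentialAlgebra

/-! ### Entire functions of polynomial growth relative to a gauge -/

/-- The entire functions whose growth on the disc of radius `r` is polynomial in `Φ R` and
`R / (R - r)`, uniformly in `1 ≤ r < R`. -/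
def polyGrowth (Φ : ℝ → ℝ) (hΦ : ∀ R, 1 ≤ Φ R) : Subalgebra ℂ (ℂ → ℂ) where
  carrier := {F | Differentiable ℂ F ∧ ∃ C : ℝ, 0 ≤ C ∧ ∃ N : ℕ, ∀ r R : ℝ, 1 ≤ r → r < R →
    ∀ z, ‖z‖ ≤ r → ‖F z‖ ≤ C * (Φ R * (R / (R - r))) ^ N}
  mul_mem' := by
    rintro F G ⟨hF, C, hC, N, hFb⟩ ⟨hG, C', hC', N', hGb⟩
    refine ⟨hF.mul hG, C * C', by positivity, N + N', fun r R hr hrR z hz => ?_⟩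
    rw [Pi.mul_apply, norm_mul, pow_add, mul_mul_mul_comm]
    exact mul_le_mul (hFb r R hr hrR z hz) (hGb r R hr hrR z hz) (norm_nonneg _)
      ((norm_nonneg _).trans (hFb r R hr hrR z hz))
  add_mem' := by
    rintro F G ⟨hF, C, hC, N, hFb⟩ ⟨hG, C', hC', N', hGb⟩
    refine ⟨hF.add hG, C + C', by positivity, N + N', fun r R hr hrR z hz => ?_⟩
    have hX : 1 ≤ Φ R * (R / (R - r)) :=
      one_le_mul_of_one_le_of_one_le (hΦ R) ((one_le_div (by linarith)).mpr (by linarith))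
    calc ‖F z + G z‖ ≤ ‖F z‖ + ‖G z‖ := norm_add_le _ _
      _ ≤ C * (Φ R * (R / (R - r))) ^ N + C' * (Φ R * (R / (R - r))) ^ N' :=
        add_le_add (hFb r R hr hrR z hz) (hGb r R hr hrR z hz)
      _ ≤ C * (Φ R * (R / (R - r))) ^ (N + N') + C' * (Φ R * (R / (R - r))) ^ (N + N') := by
        gcongr <;> first | assumption | omega
      _ = _ := by ring
  algebraMap_mem' := fun c =>
    ⟨differentiable_const c, ‖c‖, norm_nonneg c, 0, fun r R _ _ z _ => by simp⟩

section polyGrowth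

variable {Φ : ℝ → ℝ} {hΦ : ∀ R, 1 ≤ Φ R}

theorem differentiable_of_mem_polyGrowth {F : ℂ → ℂ} (hF : F ∈ polyGrowth Φ hΦ) :
    Differentiable ℂ F := hF.1

theorem deriv_mem_polyGrowth {F : ℂ → ℂ} (hF : F ∈ polyGrowth Φ hΦ) :
    deriv F ∈ polyGrowth Φ hΦ := by
  obtain ⟨hF, C, hC, N, hFb⟩ := hF
  have hF' : Differentiable ℂ (deriv F) := fun z => (hF.analyticAt z).deriv.differentiableAt
  refine ⟨hF', C * 2 ^ N * 2, by positivity, N + 1, fun r R hr hrR z hz => ?_⟩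
  have hδ : 0 < (R - r) / 2 := by linarith
  have hbound : ∀ w ∈ Metric.sphere z ((R - r) / 2),
      ‖F w‖ ≤ C * 2 ^ N * (Φ R * (R / (R - r))) ^ N := by
    intro w hw
    have hwz : ‖w - z‖ = (R - r) / 2 := mem_sphere_iff_norm.mp hw
    have hw' : ‖w‖ ≤ (r + R) / 2 := by
      have := norm_add_le (w - z) z
      rw [sub_add_cancel] at this
      linarith
    refine (hFb ((r + R) / 2) R (by linarith) (by linarith) w hw').trans_eq ?_
    rw [mul_assoc, ← mul_pow]
    congr 2
    have hsub : R - r ≠ 0 := by linarith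
    rw [show R - (r + R) / 2 = (R - r) / 2 by ring]
    field_simp
  refine (Complex.norm_deriv_le_of_forall_mem_sphere_norm_le hδ hF.diffContOnCl hbound).trans ?_
  have hX : 0 ≤ Φ R * (R / (R - r)) :=
    mul_nonneg (by linarith [hΦ R]) (div_nonneg (by linarith) (by linarith))
  have h2 : ((R - r) / 2)⁻¹ ≤ 2 * (Φ R * (R / (R - r))) := by
    have h1 : ((R - r) / 2)⁻¹ = 2 * (1 * (1 / (R - r))) := by
      rw [inv_div]; ring
    rw [h1]
    have := hΦ R
    have : 0 ≤ R - r := by linarith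
    gcongr
    linarith
  calc C * 2 ^ N * (Φ R * (R / (R - r))) ^ N / ((R - r) / 2)
      = C * 2 ^ N * (Φ R * (R / (R - r))) ^ N * ((R - r) / 2)⁻¹ := div_eq_mul_inv _ _
    _ ≤ C * 2 ^ N * (Φ R * (R / (R - r))) ^ N * (2 * (Φ R * (R / (R - r)))) := by gcongr
    _ = _ := by ring

end polyGrowth

/-! ### Bounding an entire function by the proximity function of its exponential -/

section proximity

open ValueDistribution Real

theorem proximity_top_le_of_norm_le {F : ℂ → ℂ} (hF : Differentiable ℂ F) {ρ B : ℝ} (hρ : 0 ≤ ρ)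
    (hB : 1 ≤ B) (hb : ∀ z, ‖z‖ = ρ → ‖F z‖ ≤ B) : proximity F ⊤ ρ ≤ log B := by
  rw [proximity_top]
  refine circleAverage_mono_on_of_le_circle
    (MeromorphicOn.circleIntegrable_posLog_norm fun z _ => (hF.analyticAt z).meromorphicAt)
    fun z hz => ?_
  rw [mem_sphere_iff_norm, sub_zero, abs_of_nonneg hρ] at hz
  rw [← posLog_eq_log (hB.trans (le_abs_self B))]
  exact posLog_le_posLog (norm_nonneg _) (hb z hz)

/-- Jensen's inequality for the reciprocal of an entire function, uniformly in the radius. -/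
theorem exists_proximity_inv_le {p : ℂ → ℂ} (hp : Differentiable ℂ p) :
    ∃ K : ℝ, 0 ≤ K ∧ ∀ ρ, 1 ≤ ρ → proximity p⁻¹ ⊤ ρ ≤ proximity p ⊤ ρ + K := by
  have hm : Meromorphic p := fun z => (hp.analyticAt z).meromorphicAt
  have hlog : logCounting p ⊤ = 0 := by
    have hnn : 0 ≤ MeromorphicOn.divisor p Set.univ :=
      MeromorphicOn.AnalyticOnNhd.divisor_nonneg fun z _ => hp.analyticAt z
    rw [logCounting_top, negPart_eq_zero.mpr hnn, map_zero]
  refine ⟨max |log ‖p 0‖| |log ‖meromorphicTrailingCoeffAt p 0‖|,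
    le_max_of_le_left (abs_nonneg _), fun ρ hρ => ?_⟩
  have h := (abs_le.mp (characteristic_sub_characteristic_inv_le hm (R := ρ))).1
  have h' : 0 ≤ logCounting p⁻¹ ⊤ ρ := logCounting_nonneg hρ
  simp only [characteristic, Pi.add_apply, hlog, Pi.zero_apply] at h
  linarith

theorem proximity_exp_le {p q g : ℂ → ℂ} (hp : Differentiable ℂ p) (hq : Differentiable ℂ q)
    (hp0 : p ≠ 0) (hpq : ∀ z, p z * Complex.exp (g z) = q z) {ρ : ℝ} (hρ : ρ ≠ 0) :
    proximity (fun z => Complex.exp (g z)) ⊤ ρ ≤ proximity p⁻¹ ⊤ ρ + proximity q ⊤ ρ := by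
  have hpm : Meromorphic p := fun z => (hp.analyticAt z).meromorphicAt
  have hqm : Meromorphic q := fun z => (hq.analyticAt z).meromorphicAt
  obtain ⟨z₀, hz₀⟩ := Function.ne_iff.mp hp0
  have hcod : {z | p z ≠ 0} ∈ Filter.codiscrete ℂ :=
    AnalyticOnNhd.preimage_zero_mem_codiscrete (f := p) (fun z _ => hp.analyticAt z) hz₀
  have heq : (fun z => Complex.exp (g z)) =ᶠ[Filter.codiscrete ℂ] p⁻¹ * q := by
    filter_upwards [hcod] with z hz
    rw [Pi.mul_apply, Pi.inv_apply, ← hpq, inv_mul_cancel_left₀ hz]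
  rw [proximity_congr_codiscrete heq hρ]
  exact proximity_mul_top_le hpm.inv hqm ρ

theorem re_le_mul_proximity_exp {g : ℂ → ℂ} (hg : Differentiable ℂ g) {r ρ : ℝ} (hrρ : r < ρ)
    {w : ℂ} (hw : ‖w‖ ≤ r) :
    (g w).re ≤ (ρ + r) / (ρ - r) * proximity (fun z => Complex.exp (g z)) ⊤ ρ := by
  have hr : 0 ≤ r := (norm_nonneg w).trans hw
  have hwb : w ∈ Metric.ball (0 : ℂ) ρ := by simpa using hw.trans_lt hrρ
  have hposson := InnerProductSpace.HarmonicOnNhd.circleAverage_poissonKernel_smul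
    (f := fun z => (g z).re) (c := 0) (R := ρ) (fun z _ => (hg.analyticAt z).harmonicAt_re) hwb
  have hm : Meromorphic fun z => Complex.exp (g z) :=
    fun z => (hg.cexp.analyticAt z).meromorphicAt
  rw [proximity_top, ← smul_eq_mul, ← circleAverage_smul, ← hposson]
  refine circleAverage_mono ?_ ?_ fun z hz => ?_
  · refine ContinuousOn.circleIntegrable (hr.trans hrρ.le) (ContinuousOn.smul ?_ ?_)
    · refine ContinuousOn.div (by fun_prop) (by fun_prop) fun z hz => ?_
      have : z ≠ w := by
        rintro rfl
        rw [mem_sphere_iff_norm, sub_zero] at hz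
        linarith
      simpa [sub_eq_zero] using this
    · exact (Complex.continuous_re.comp hg.continuous).continuousOn
  · exact (MeromorphicOn.circleIntegrable_posLog_norm fun z _ => hm z).const_smul
  · rw [abs_of_nonneg (hr.trans hrρ.le)] at hz
    have hupper : poissonKernel 0 w z ≤ (ρ + r) / (ρ - r) := by
      rw [poissonKernel_eq_re_herglotzRieszKernel]
      refine (re_herglotzRieszKernel_le hz hwb).trans ?_
      rw [sub_zero]
      have : 0 < ρ - r := by linarith
      have : 0 ≤ ρ + r := by linarith
      gcongr
    have hlower : 0 ≤ poissonKernel 0 w z := by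
      rw [mem_sphere_iff_norm, sub_zero] at hz
      rw [poissonKernel_def, sub_zero, sub_zero, hz]
      have := hw.trans hrρ.le
      refine div_nonneg (sub_nonneg.mpr ?_) (by positivity)
      gcongr
    have hlog : log⁺ ‖Complex.exp (g z)‖ = max 0 (g z).re := by
      rw [Complex.norm_exp, posLog, log_exp]
    simp only [Pi.smul_apply', Pi.smul_apply, smul_eq_mul, hlog]
    exact (mul_le_mul_of_nonneg_left (le_max_right _ _) hlower).trans
      (mul_le_mul_of_nonneg_right hupper (le_max_left _ _))

end proximity

/-! ### Growth of entire functions with exponential in the quotient field of `polyGrowth` -/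

section growth

open ValueDistribution Real

variable {Φ : ℝ → ℝ} {hΦ : ∀ R, 1 ≤ Φ R}

theorem exists_proximity_le_of_mem_polyGrowth {F : ℂ → ℂ} (hF : F ∈ polyGrowth Φ hΦ) :
    ∃ K : ℝ, 0 ≤ K ∧ ∀ r R, 1 ≤ r → r < R →
      proximity F ⊤ r ≤ K * (R / (R - r)) * √(Φ R) := by
  obtain ⟨hF, C, hC, N, hFb⟩ := hF
  refine ⟨C + 2 * N, by positivity, fun r R hr hrR => ?_⟩
  have hX : 1 ≤ R / (R - r) := (one_le_div (by linarith)).mpr (by linarith)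
  have hsΦ : 1 ≤ √(Φ R) := one_le_sqrt.mpr (hΦ R)
  set X := R / (R - r)
  have hY : 1 ≤ Φ R * X := one_le_mul_of_one_le_of_one_le (hΦ R) hX
  have hXΦ : 1 ≤ X * √(Φ R) := one_le_mul_of_one_le_of_one_le hX hsΦ
  have hpow : 1 ≤ (Φ R * X) ^ N := one_le_pow₀ hY
  have hbound : ∀ z, ‖z‖ = r → ‖F z‖ ≤ (C + 1) * (Φ R * X) ^ N := fun z hz =>
    (hFb r R hr hrR z hz.le).trans (by gcongr; linarith)
  have hlogY : log (Φ R * X) ≤ 2 * (X * √(Φ R)) := by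
    have hsq : √(Φ R * X) ≤ X * √(Φ R) := by
      rw [sqrt_mul (by linarith [hΦ R]), mul_comm]
      gcongr
      exact sqrt_le_iff.mpr ⟨by linarith, by nlinarith⟩
    have := log_sqrt (zero_le_one.trans hY)
    have := log_le_sub_one_of_pos (sqrt_pos.mpr (one_pos.trans_le hY))
    linarith
  have hlogC : log (C + 1) ≤ C := by linarith [log_le_sub_one_of_pos (show 0 < C + 1 by linarith)]
  calc proximity F ⊤ r ≤ log ((C + 1) * (Φ R * X) ^ N) :=
        proximity_top_le_of_norm_le hF (by linarith)
          (one_le_mul_of_one_le_of_one_le (by linarith) hpow) hbound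
    _ = log (C + 1) + N * log (Φ R * X) := by
        rw [log_mul (by linarith) (by linarith), log_pow]
    _ ≤ C * (X * √(Φ R)) + N * (2 * (X * √(Φ R))) := by
        gcongr
        exact hlogC.trans (le_mul_of_one_le_right hC hXΦ)
    _ = _ := by ring

/-- If `exp g` is a quotient of functions of polynomial growth relative to `Φ`, then `g` grows at
most like `√Φ`. -/
theorem exists_norm_le_of_mul_exp_eq {p q g : ℂ → ℂ} (hp : p ∈ polyGrowth Φ hΦ)
    (hq : q ∈ polyGrowth Φ hΦ) (hp0 : p ≠ 0) (hg : Differentiable ℂ g)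
    (hpq : ∀ z, p z * Complex.exp (g z) = q z) :
    ∃ K : ℝ, 0 ≤ K ∧ ∀ r R, 1 ≤ r → r < R → ∀ z, ‖z‖ ≤ r →
      ‖g z‖ ≤ K * (R / (R - r)) ^ 3 * √(Φ R) := by
  obtain ⟨Kp, hKp, hKpb⟩ := exists_proximity_le_of_mem_polyGrowth hp
  obtain ⟨Kq, hKq, hKqb⟩ := exists_proximity_le_of_mem_polyGrowth hq
  obtain ⟨K₀, hK₀, hK₀b⟩ := exists_proximity_inv_le (differentiable_of_mem_polyGrowth hp)
  refine ⟨36 * (3 * (Kp + Kq + K₀) + 1) + 6 * ‖g 0‖, by positivity, fun r R hr hrR z hz => ?_⟩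
  obtain ⟨δ, hδ⟩ : ∃ δ, δ = (R - r) / 3 := ⟨_, rfl⟩
  have hδ0 : 0 < δ := by linarith
  have hX : 1 ≤ R / (R - r) := (one_le_div (by linarith)).mpr (by linarith)
  have hXδ : R / δ = 3 * (R / (R - r)) := by
    rw [hδ]; field_simp
  have hsΦ : 1 ≤ √(Φ R) := one_le_sqrt.mpr (hΦ R)
  set X := R / (R - r)
  set L := 3 * (Kp + Kq + K₀) with hL
  have hL0 : 0 ≤ L := by positivity
  have hXΦ : 1 ≤ X * √(Φ R) := one_le_mul_of_one_le_of_one_le hX hsΦ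
  have hprox : proximity (fun z => Complex.exp (g z)) ⊤ (r + 2 * δ) ≤ L * (X * √(Φ R)) := by
    have h₁ := proximity_exp_le (differentiable_of_mem_polyGrowth hp)
      (differentiable_of_mem_polyGrowth hq) hp0 hpq (ρ := r + 2 * δ) (by linarith)
    have h₂ := hK₀b (r + 2 * δ) (by linarith)
    have h₃ := hKpb (r + 2 * δ) R (by linarith) (by linarith)
    have h₄ := hKqb (r + 2 * δ) R (by linarith) (by linarith)
    rw [show R - (r + 2 * δ) = δ by linarith, hXδ] at h₃ h₄
    have h₅ : K₀ ≤ K₀ * (X * √(Φ R)) := le_mul_of_one_le_right hK₀ hXΦ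
    have h₆ : 0 ≤ K₀ * (X * √(Φ R)) := hK₀.trans h₅
    linear_combination h₁ + h₂ + h₃ + h₄ + h₅ + 2 * h₆
  set M := 6 * X * ((L + 1) * (X * √(Φ R))) with hM
  have hM0 : 0 < M := by positivity
  have hre : Set.MapsTo g (Metric.ball 0 (r + δ)) {w | w.re ≤ M} := by
    intro w hw
    rw [mem_ball_zero_iff] at hw
    refine (re_le_mul_proximity_exp hg (show r + δ < r + 2 * δ by linarith) hw.le).trans ?_
    have h : (r + 2 * δ + (r + δ)) / (r + 2 * δ - (r + δ)) ≤ 6 * X := by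
      rw [show r + 2 * δ - (r + δ) = δ by ring,
        show 6 * X = 2 * R / δ by linear_combination -2 * hXδ]
      gcongr
      linarith
    have h0 : 0 ≤ (r + 2 * δ + (r + δ)) / (r + 2 * δ - (r + δ)) :=
      div_nonneg (by linarith) (by linarith)
    calc _ ≤ (r + 2 * δ + (r + δ)) / (r + 2 * δ - (r + δ)) * ((L + 1) * (X * √(Φ R))) := by
          gcongr
          linarith
      _ ≤ M := by rw [hM]; gcongr
  have hBC := Complex.borelCaratheodory hM0 hg.differentiableOn hre (by linarith)
    (mem_ball_zero_iff.mpr (by linarith : ‖z‖ < r + δ))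
  have hR0 : 0 ≤ R := by linarith
  have h₁ : 2 * M * ‖z‖ / (r + δ - ‖z‖) ≤ 6 * X * M := by
    calc _ ≤ 2 * M * R / δ := by
          gcongr <;> first | positivity | linarith
      _ = _ := by linear_combination 2 * M * hXδ
  have h₂ : ‖g 0‖ * (r + δ + ‖z‖) / (r + δ - ‖z‖) ≤ 6 * ‖g 0‖ * X := by
    calc _ ≤ ‖g 0‖ * (2 * R) / δ := by
          gcongr <;> first | positivity | linarith
      _ = _ := by linear_combination 2 * ‖g 0‖ * hXδ
  have h₃ : 6 * ‖g 0‖ * X ≤ 6 * ‖g 0‖ * (X ^ 3 * √(Φ R)) := by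
    gcongr
    calc X = X * 1 * 1 := by ring
      _ ≤ X * X ^ 2 * √(Φ R) := by
        gcongr
        exact one_le_pow₀ hX
      _ = _ := by ring
  calc ‖g z‖ ≤ 6 * X * M + 6 * ‖g 0‖ * (X ^ 3 * √(Φ R)) := hBC.trans (add_le_add h₁ (h₂.trans h₃))
    _ = _ := by rw [hM]; ring

end growth

/-- A monotone gauge that is dominated by its own square root on slightly larger discs is
bounded. -/
theorem exists_le_of_le_mul_sqrt {Φ : ℝ → ℝ} (hΦ : ∀ R, 1 ≤ Φ R) (hmono : Monotone Φ) {K : ℝ}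
    (hK : 0 ≤ K) (h : ∀ r R, 1 ≤ r → r < R → Φ r ≤ K * (R / (R - r)) ^ 3 * √(Φ R)) :
    ∃ B, ∀ ρ, 1 ≤ ρ → Φ ρ ≤ B := by
  refine ⟨K ^ 2 * 8 ^ 6, fun ρ hρ => ?_⟩
  let e : ℝ → ℝ := fun r => Φ r * ((2 * ρ - r) / ρ) ^ 6
  have hρ0 : 0 < ρ := by linarith
  have hbdd : BddAbove (e '' Set.Ico ρ (2 * ρ)) := by
    refine ⟨Φ (2 * ρ) * 1 ^ 6, ?_⟩
    rintro _ ⟨r, ⟨hr, hr'⟩, rfl⟩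
    have := hΦ (2 * ρ)
    have h0 : 0 ≤ (2 * ρ - r) / ρ := div_nonneg (by linarith) hρ0.le
    have h1 : (2 * ρ - r) / ρ ≤ 1 := (div_le_one hρ0).mpr (by linarith)
    have := hmono hr'.le
    exact mul_le_mul this (by gcongr) (by positivity) (by linarith)
  set s := sSup (e '' Set.Ico ρ (2 * ρ)) with hs
  have hle : ∀ r ∈ Set.Ico ρ (2 * ρ), e r ≤ s := fun r hr => le_csSup hbdd ⟨r, hr, rfl⟩
  have hρe : e ρ = Φ ρ := by
    simp only [e]
    rw [show (2 * ρ - ρ) / ρ = 1 by field_simp; ring]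
    ring
  have hρs : Φ ρ ≤ s := hρe ▸ hle ρ ⟨le_rfl, by linarith⟩
  have hs0 : 0 < s := by linarith [hΦ ρ]
  refine hρs.trans ?_
  have hsq : ∀ r ∈ Set.Ico ρ (2 * ρ), e r ≤ √(K ^ 2 * 8 ^ 6 * s) := by
    rintro r ⟨hr, hr'⟩
    refine Real.le_sqrt_of_sq_le ?_
    have hR := hle ((r + 2 * ρ) / 2) ⟨by linarith, by linarith⟩
    have hb := h r ((r + 2 * ρ) / 2) (by linarith) (by linarith)
    have hsqrt := Real.sq_sqrt (zero_le_one.trans (hΦ ((r + 2 * ρ) / 2)))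
    simp only [e] at hR ⊢
    set R := (r + 2 * ρ) / 2 with hRdef
    have hd : R - r = (2 * ρ - r) / 2 := by rw [hRdef]; ring
    have hd' : 2 * ρ - R = (2 * ρ - r) / 2 := by rw [hRdef]; ring
    obtain ⟨u, hu⟩ : ∃ u, u = (2 * ρ - r) / ρ := ⟨_, rfl⟩
    have hu0 : 0 < u := hu ▸ div_pos (by linarith) hρ0
    have hX : R / (R - r) ≤ 4 / u := by
      rw [hd, hu]
      have : 0 < 2 * ρ - r := by linarith
      rw [div_div_eq_mul_div, div_div_eq_mul_div]
      exact div_le_div_of_nonneg_right (by linarith) this.le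
    have hX0 : 0 ≤ R / (R - r) := div_nonneg (by linarith) (by linarith)
    rw [hd', show (2 * ρ - r) / 2 / ρ = u / 2 by rw [hu]; ring] at hR
    rw [← hu]
    have h1 : Φ r * u ^ 6 ≤ K * 4 ^ 3 * √(Φ R) * u ^ 3 := by
      calc Φ r * u ^ 6 ≤ K * (4 / u) ^ 3 * √(Φ R) * u ^ 6 := by
            gcongr
            refine hb.trans ?_
            gcongr
        _ = _ := by field_simp
    calc (Φ r * u ^ 6) ^ 2 ≤ (K * 4 ^ 3 * √(Φ R) * u ^ 3) ^ 2 := by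
          have := hΦ r
          gcongr
      _ = K ^ 2 * 8 ^ 6 * (Φ R * (u / 2) ^ 6) := by
          linear_combination K ^ 2 * 4 ^ 6 * u ^ 6 * hsqrt
      _ ≤ K ^ 2 * 8 ^ 6 * s := by gcongr
  have hsle : s ≤ √(K ^ 2 * 8 ^ 6 * s) := by
    refine csSup_le ⟨_, ρ, ⟨le_rfl, by linarith⟩, rfl⟩ ?_
    rintro _ ⟨r, hr, rfl⟩
    exact hsq r hr
  rw [Real.le_sqrt hs0.le (by positivity), sq] at hsle
  exact le_of_mul_le_mul_right hsle hs0

/-! ### Borel's theorem on linear relations between exponentials of entire functions -/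

theorem exists_forall_eq_of_minimal_sum_exp_eq_zero {ι : Type*} [Fintype ι] {g : ι → ℂ → ℂ}
    (hg : ∀ i, Differentiable ℂ (g i)) (c : ι → ℂ)
    (hsum : ∀ z, ∑ i, c i * Complex.exp (g i z) = 0)
    (hmin : ∀ t : Finset ι, t.Nonempty → (∀ z, ∑ i ∈ t, c i * Complex.exp (g i z) = 0) →
      t = Finset.univ)
    {i₀ : ι} (hi₀ : g i₀ = 0) (i : ι) (z w : ℂ) : g i z = g i w := by
  let m : ι → ℝ → ℝ := fun i R => sSup ((fun z => ‖g i z‖) '' Metric.closedBall 0 (max R 0))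
  have hbdd : ∀ i R, BddAbove ((fun z => ‖g i z‖) '' Metric.closedBall 0 (max R 0)) := fun i R =>
    ((isCompact_closedBall _ _).image (hg i).continuous.norm).bddAbove
  have hne : ∀ i R, ((fun z => ‖g i z‖) '' Metric.closedBall 0 (max R 0)).Nonempty := fun i R =>
    ⟨_, 0, by simp, rfl⟩
  have hle : ∀ i R z, ‖z‖ ≤ R → ‖g i z‖ ≤ m i R := fun i R z hz =>
    le_csSup (hbdd i R) ⟨z, by simp [hz], rfl⟩
  have hm0 : ∀ i R, 0 ≤ m i R := fun i R =>
    (norm_nonneg _).trans (le_csSup (hbdd i R) ⟨0, by simp, rfl⟩)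
  have hmmono : ∀ i, Monotone (m i) := fun i R R' h =>
    csSup_le_csSup (hbdd i R') (hne i R) (Set.image_mono (Metric.closedBall_subset_closedBall
      (max_le_max_right 0 h)))
  let Φ : ℝ → ℝ := fun R => 1 + ∑ i, m i R
  have hΦ : ∀ R, 1 ≤ Φ R := fun R =>
    le_add_of_nonneg_right (Finset.sum_nonneg fun i _ => hm0 i R)
  have hmΦ : ∀ i R, m i R ≤ Φ R := fun i R =>
    (Finset.single_le_sum (f := fun i => m i R) (fun i _ => hm0 i R) (Finset.mem_univ i)).trans
      (le_add_of_nonneg_left zero_le_one)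
  have hmono : Monotone Φ := fun R R' h =>
    add_le_add_right (Finset.sum_le_sum fun i _ => hmmono i h) 1
  have hgA : ∀ i, g i ∈ polyGrowth Φ hΦ := fun i =>
    ⟨hg i, 1, zero_le_one, 1, fun r R hr hrR z hz => by
      have hX : 1 ≤ R / (R - r) := (one_le_div (by linarith)).mpr (by linarith)
      rw [pow_one, one_mul]
      exact ((hle i R z (hz.trans hrR.le)).trans (hmΦ i R)).trans
        (le_mul_of_one_le_right (by linarith [hΦ R]) hX)⟩
  have hgrowth : ∀ i, ∃ K : ℝ, 0 ≤ K ∧ ∀ r R, 1 ≤ r → r < R → ∀ z, ‖z‖ ≤ r →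
      ‖g i z‖ ≤ K * (R / (R - r)) ^ 3 * √(Φ R) := by
    intro i
    obtain ⟨p, hp, q, hq, hp0, -, hpq⟩ := expRelated_of_minimal_sum_eq_zero
      (A := polyGrowth Φ hΦ) (fun f => differentiable_of_mem_polyGrowth)
      (fun f => deriv_mem_polyGrowth) hg (fun i => deriv_mem_polyGrowth (hgA i)) c hsum hmin i i₀
    exact exists_norm_le_of_mul_exp_eq hp hq hp0 (hg i) fun z => by simpa [hi₀] using hpq z
  choose K hK hKb using hgrowth
  obtain ⟨B, hB⟩ := exists_le_of_le_mul_sqrt hΦ hmono (K := 1 + ∑ i, K i)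
    (by linarith [Finset.sum_nonneg fun i (_ : i ∈ Finset.univ) => hK i]) fun r R hr hrR => by
      have hX : 1 ≤ R / (R - r) := (one_le_div (by linarith)).mpr (by linarith)
      have hone : 1 ≤ 1 * (R / (R - r)) ^ 3 * √(Φ R) := by
        rw [one_mul]
        exact one_le_mul_of_one_le_of_one_le (one_le_pow₀ hX) (Real.one_le_sqrt.mpr (hΦ R))
      rw [add_mul, add_mul, Finset.sum_mul, Finset.sum_mul]
      refine add_le_add hone (Finset.sum_le_sum fun i _ => csSup_le (hne i r) ?_)
      rintro _ ⟨z, hz, rfl⟩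
      rw [mem_closedBall_zero_iff, max_eq_left (zero_le_one.trans hr)] at hz
      exact hKb i r R hr hrR z hz
  refine (hg i).apply_eq_apply_of_bounded (isBounded_iff_forall_norm_le.mpr ⟨B, ?_⟩) z w
  rintro _ ⟨z, rfl⟩
  exact ((hle i _ z (le_max_left ‖z‖ 1)).trans (hmΦ i _)).trans (hB _ (le_max_right _ _))

/-- **Borel's theorem**: exponentials of entire functions, no two of which differ by a constant,
are linearly independent over `ℂ`. -/
theorem eq_zero_of_sum_mul_exp_eq_zero {ι : Type*} (s : Finset ι) {h : ι → ℂ → ℂ}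
    (hh : ∀ i ∈ s, Differentiable ℂ (h i))
    (hdist : ∀ i ∈ s, ∀ j ∈ s, i ≠ j → ¬ ∃ k : ℂ, ∀ z, h i z - h j z = k) (c : ι → ℂ)
    (hsum : ∀ z, ∑ i ∈ s, c i * Complex.exp (h i z) = 0) : ∀ i ∈ s, c i = 0 := by
  classical
  induction s using Finset.strongInduction with
  | H s ih =>
  have hsub : ∀ t ⊂ s, (∀ z, ∑ i ∈ t, c i * Complex.exp (h i z) = 0) → ∀ i ∈ t, c i = 0 :=
    fun t ht => ih t ht (fun i hi => hh i (ht.1 hi))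
      fun i hi j hj => hdist i (ht.1 hi) j (ht.1 hj)
  by_contra! hne
  obtain ⟨i₀, hi₀, hc₀⟩ := hne
  have hc : ∀ i ∈ s, c i ≠ 0 := by
    intro i hi hci
    refine hc₀ (hsub (s.erase i) (Finset.erase_ssubset hi) (fun z => ?_) i₀
      (Finset.mem_erase.mpr ⟨fun h => hc₀ (h ▸ hci), hi₀⟩))
    rw [Finset.sum_erase _ (by simp [hci]), hsum]
  have hmul : ∀ (t : Finset s) (z : ℂ), ∑ i ∈ t, c i * Complex.exp (h i z - h i₀ z) =
      Complex.exp (-h i₀ z) * ∑ i ∈ t.map (Function.Embedding.subtype _),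
        c i * Complex.exp (h i z) := by
    intro t z
    rw [Finset.sum_map, Finset.mul_sum]
    refine Finset.sum_congr rfl fun i _ => ?_
    rw [sub_eq_add_neg, Complex.exp_add, Function.Embedding.subtype_apply]
    ring
  have hconst := exists_forall_eq_of_minimal_sum_exp_eq_zero
    (g := fun (i : s) z => h i z - h i₀ z) (fun i => (hh i i.2).sub (hh i₀ hi₀)) (fun i => c i)
    (fun z => by
      rw [hmul, Finset.univ_eq_attach, Finset.attach_map_val, hsum, mul_zero])
    (fun t ht hts => by
      by_contra htu
      have hsum' : ∀ z, ∑ i ∈ t.map (Function.Embedding.subtype _),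
          c i * Complex.exp (h i z) = 0 := fun z =>
        (mul_eq_zero.mp ((hmul t z).symm.trans (hts z))).resolve_left (Complex.exp_ne_zero _)
      obtain ⟨i, hi⟩ := ht
      refine hc i i.2 (hsub _ ?_ hsum' i (Finset.mem_map_of_mem _ hi))
      have := Finset.map_ssubset_map (f := Function.Embedding.subtype (· ∈ s)).mpr
        (Finset.ssubset_univ_iff.mpr htu)
      rwa [Finset.univ_eq_attach, Finset.attach_map_val] at this)
    (i₀ := ⟨i₀, hi₀⟩) (by ext; simp)
  have hs : s = {i₀} := by
    refine Finset.eq_singleton_iff_unique_mem.mpr ⟨hi₀, fun i hi => ?_⟩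
    by_contra hne
    exact hdist i hi i₀ hi₀ hne ⟨_, fun z => hconst ⟨i, hi⟩ z 0⟩
  have := hsum 0
  rw [hs, Finset.sum_singleton] at this
  exact (mul_ne_zero hc₀ (Complex.exp_ne_zero _)) this

/-! ### Entire curves in the complement of a hypersurface of the torus -/

theorem exists_entire_exp_eq {f : ℂ → ℂ} (hf : Differentiable ℂ f) (hf0 : ∀ z, f z ≠ 0) :
    ∃ g : ℂ → ℂ, Differentiable ℂ g ∧ ∀ z, f z = Complex.exp (g z) := by
  have hf' : Differentiable ℂ (deriv f) := fun z => (hf.analyticAt z).deriv.differentiableAt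
  obtain ⟨g, hg0, hg⟩ :=
    (hf'.div hf hf0).isExactOn_univ.with_val_at 0 (Complex.log (f 0))
  have hgd : Differentiable ℂ g := fun z => (hg z trivial).differentiableAt
  refine ⟨g, hgd, fun z => ?_⟩
  have hconst := is_const_of_deriv_eq_zero (f := fun z => f z * Complex.exp (-g z))
    (by fun_prop) (fun z => by
      have h := (hf z).hasDerivAt.mul (hg z trivial).neg.cexp
      rw [show (fun z => f z * Complex.exp (-g z)) = f * fun z => Complex.exp (-g z) from rfl]
      refine h.deriv.trans ?_
      simp only [Pi.div_apply, Pi.neg_apply]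
      field_simp [hf0 z]
      ring) z 0
  simp only [hg0, Complex.exp_neg, Complex.exp_log (hf0 0), mul_inv_cancel₀ (hf0 0)] at hconst
  exact (mul_inv_eq_one₀ (Complex.exp_ne_zero _)).mp hconst

/-- Every integral relation satisfied by a nonzero complex vector is also satisfied by some
nonzero integral vector. -/
theorem exists_int_ne_zero_of_relations {ι : Type*} [Fintype ι] {w : ι → ℂ} (hw : w ≠ 0) :
    ∃ v : ι → ℤ, v ≠ 0 ∧ ∀ I : ι → ℤ, ∑ i, (I i : ℂ) * w i = 0 → ∑ i, I i * v i = 0 := by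
  obtain ⟨i₀, hi₀⟩ := Function.ne_iff.mp hw
  obtain ⟨ψ, hψ⟩ : ∃ ψ : Module.Dual ℚ ℂ, ψ (w i₀) ≠ 0 := by
    by_contra! h
    exact hi₀ ((Module.forall_dual_apply_eq_zero_iff ℚ _).mp h)
  obtain ⟨b, hb⟩ := IsLocalization.exist_integer_multiples_of_finite (nonZeroDivisors ℤ)
    fun i => ψ (w i)
  choose v hv using hb
  have hb0 : ((b : ℤ) : ℚ) ≠ 0 := Int.cast_ne_zero.mpr (nonZeroDivisors.ne_zero b.2)
  have hv' : ∀ i, (v i : ℚ) = (b : ℤ) * ψ (w i) := fun i => by simpa using hv i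
  refine ⟨v, fun h => ?_, fun I hI => ?_⟩
  · have := hv' i₀
    rw [h, Pi.zero_apply, Int.cast_zero] at this
    exact mul_ne_zero hb0 hψ this.symm
  · have h := congrArg ψ hI
    simp only [map_sum, map_zero, ← zsmul_eq_mul, map_zsmul] at h
    have : ((∑ i, I i * v i : ℤ) : ℚ) = (b : ℤ) * ∑ i, I i • ψ (w i) := by
      push_cast
      rw [Finset.mul_sum]
      refine Finset.sum_congr rfl fun i _ => ?_
      rw [hv', zsmul_eq_mul]
      ring
    rw [h, mul_zero] at this
    exact_mod_cast this

theorem lmon_exp {r : ℕ} (u : Fin r → ℂ) (I : Fin r → ℤ) :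
    lmon (fun i => Complex.exp (u i)) I = Complex.exp (∑ i, I i * u i) := by
  simp only [lmon, Complex.exp_sum, Complex.exp_int_mul]

theorem lmon_mul_zpow {r : ℕ} (c : Fin r → ℂ) {t : ℂ} (ht : t ≠ 0) (v I : Fin r → ℤ) :
    lmon (fun i => c i * t ^ v i) I = lmon c I * t ^ ∑ i, I i * v i := by
  simp only [lmon, mul_zpow, Finset.prod_mul_distrib]
  congr 1
  simp only [← zpow_mul, mul_comm (v _)]
  induction (Finset.univ : Finset (Fin r)) using Finset.cons_induction with
  | empty => simp
  | cons i s hi ih => rw [Finset.prod_cons, Finset.sum_cons, zpow_add₀ ht, ih]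

/-- If a finite sum of exponentials of entire functions is itself the exponential of an entire
function `h`, then, grouping the terms by their exponents up to constants, all groups cancel but
the one of `h`. -/
theorem sum_filter_eq_ite_of_sum_exp_eq_exp {κ : Type*} (S : Finset κ) (a : κ → ℂ)
    {L : κ → ℂ → ℂ} (hL : ∀ I, Differentiable ℂ (L I)) {h : ℂ → ℂ} (hh : Differentiable ℂ h)
    (hsum : ∀ z, ∑ I ∈ S, a I * Complex.exp (L I z) = Complex.exp (h z)) (φ : ℂ → ℂ)
    [DecidableEq (ℂ → ℂ)] :
    ∑ I ∈ S with (fun z => L I z - L I 0) = φ, a I * Complex.exp (L I 0) =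
      if φ = (fun z => h z - h 0) then Complex.exp (h 0) else 0 := by
  set key : κ → ℂ → ℂ := fun I z => L I z - L I 0
  set φ₀ : ℂ → ℂ := fun z => h z - h 0
  let s : Finset (ℂ → ℂ) := insert φ₀ (S.image key)
  let c : (ℂ → ℂ) → ℂ := fun φ =>
    ∑ I ∈ S with key I = φ, a I * Complex.exp (L I 0) - if φ = φ₀ then Complex.exp (h 0) else 0
  have hs : ∀ φ ∈ s, Differentiable ℂ φ ∧ φ 0 = 0 := by
    intro φ hφ
    rcases Finset.mem_insert.mp hφ with rfl | hφ
    · exact ⟨hh.sub_const _, sub_self _⟩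
    · obtain ⟨I, -, rfl⟩ := Finset.mem_image.mp hφ
      exact ⟨(hL I).sub_const _, sub_self _⟩
  by_cases hφ : φ ∈ s
  · refine sub_eq_zero.mp (eq_zero_of_sum_mul_exp_eq_zero s (h := id) (fun φ hφ => (hs φ hφ).1)
      ?_ c (fun z => ?_) φ hφ)
    · rintro φ hφ φ' hφ' hne ⟨k, hk⟩
      refine hne (funext fun z => sub_eq_zero.mp ?_)
      have h0 := hk 0
      rw [id, id, (hs φ hφ).2, (hs φ' hφ').2, sub_zero] at h0
      exact (hk z).trans h0.symm
    · have h₁ : ∑ φ ∈ s, (∑ I ∈ S with key I = φ, a I * Complex.exp (L I 0)) *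
          Complex.exp (φ z) = ∑ I ∈ S, a I * Complex.exp (L I z) := by
        rw [← Finset.sum_fiberwise_of_maps_to (g := key) (t := s)
          fun I hI => Finset.mem_insert_of_mem (Finset.mem_image_of_mem _ hI)]
        refine Finset.sum_congr rfl fun φ _ => ?_
        rw [Finset.sum_mul]
        refine Finset.sum_congr rfl fun I hI => ?_
        rw [← (Finset.mem_filter.mp hI).2, mul_assoc, ← Complex.exp_add, add_sub_cancel]
      have h₂ : ∑ φ ∈ s, (if φ = φ₀ then Complex.exp (h 0) else 0) * Complex.exp (φ z) =
          Complex.exp (h z) := by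
        simp only [ite_mul, zero_mul]
        rw [Finset.sum_ite_eq' s φ₀, if_pos (Finset.mem_insert_self _ _), ← Complex.exp_add,
          add_sub_cancel]
      simp only [c, sub_mul, Finset.sum_sub_distrib, id]
      rw [h₁, h₂, hsum, sub_self]
  · rw [if_neg fun hφ₀ : φ = φ₀ => hφ (hφ₀ ▸ Finset.mem_insert_self _ _), Finset.sum_filter,
      Finset.sum_eq_zero]
    intro I hI
    exact if_neg fun hI' : key I = φ =>
      hφ (hI' ▸ Finset.mem_insert_of_mem (Finset.mem_image_of_mem _ hI))

/-- If the complement `(ℂ*)^r \ Z(p_a)` contains no coset of a one-dimensional subtorus,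
then every entire map `f : ℂ → ℂ^r` with nowhere-vanishing coordinates avoiding the zero
set of `p_a` is constant. -/
theorem entire_curve_in_complement_is_constant {r : ℕ} (hr : 1 ≤ r)
    (S : Finset (Fin r → ℤ)) (a : (Fin r → ℤ) → ℂ)
    (hnc : ¬ ∃ c : Fin r → ℂ, ∃ v : Fin r → ℤ, (∀ i, c i ≠ 0) ∧ v ≠ 0 ∧
        coset c v ⊆ torus r \ Zset S a) :
    ∀ f : ℂ → (Fin r → ℂ),
      (∀ i, Differentiable ℂ (fun ζ => f ζ i)) →
      (∀ ζ : ℂ, ∀ i, f ζ i ≠ 0) →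
      (∀ ζ : ℂ, pa S a (f ζ) ≠ 0) →
      ∀ ζ₁ ζ₂ : ℂ, f ζ₁ = f ζ₂ := by
  classical
  intro f hf hf0 hfa ζ₁ ζ₂
  by_contra hne
  refine hnc ?_
  choose g hg hfg using fun i => exists_entire_exp_eq (hf i) fun ζ => hf0 ζ i
  let L : (Fin r → ℤ) → ℂ → ℂ := fun I ζ => ∑ i, I i * g i ζ
  have hL : ∀ I, Differentiable ℂ (L I) := fun I =>
    Differentiable.fun_sum fun i _ => (hg i).const_mul _
  have hlmon : ∀ ζ I, lmon (f ζ) I = Complex.exp (L I ζ) := fun ζ I => by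
    rw [show f ζ = fun i => Complex.exp (g i ζ) from funext fun i => hfg i ζ, lmon_exp]
  have hpa : ∀ ζ, pa S a (f ζ) = ∑ I ∈ S, a I * Complex.exp (L I ζ) := fun ζ => by
    simp only [pa, hlmon]
  obtain ⟨h, hh, hpah⟩ := exists_entire_exp_eq (f := fun ζ => pa S a (f ζ))
    (by
      simp only [hpa]
      exact Differentiable.fun_sum fun I _ => (hL I).cexp.const_mul _) hfa
  have hgroup := sum_filter_eq_ite_of_sum_exp_eq_exp S a hL hh fun ζ => (hpa ζ).symm.trans (hpah ζ)
  set key : (Fin r → ℤ) → ℂ → ℂ := fun I ζ => L I ζ - L I 0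
  set φ₀ : ℂ → ℂ := fun ζ => h ζ - h 0
  obtain ⟨i₁, hi₁⟩ := Function.ne_iff.mp hne
  obtain ⟨ζ₀, hζ₀⟩ : ∃ ζ₀, deriv (g i₁) ζ₀ ≠ 0 := by
    by_contra! hd
    exact hi₁ (by rw [hfg, hfg, is_const_of_deriv_eq_zero (hg i₁) hd ζ₁ ζ₂])
  obtain ⟨v, hv, hvI⟩ := exists_int_ne_zero_of_relations (w := fun i => deriv (g i) ζ₀)
    (Function.ne_iff.mpr ⟨i₁, hζ₀⟩)
  have hkey : ∀ I, deriv (key I) ζ₀ = ∑ i, I i * deriv (g i) ζ₀ := by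
    intro I
    rw [show key I = fun ζ => L I ζ - L I 0 from rfl, deriv_sub_const]
    exact (HasDerivAt.fun_sum fun i _ => (hg i ζ₀).hasDerivAt.const_mul (I i : ℂ)).deriv
  have hdeg : ∀ I J, key I = key J → ∑ i, I i * v i = ∑ i, J i * v i := by
    intro I J hIJ
    have h₁ := hvI (I - J) (by
      simp only [Pi.sub_apply, Int.cast_sub, sub_mul, Finset.sum_sub_distrib]
      rw [← hkey, ← hkey, hIJ, sub_self])
    simpa only [Pi.sub_apply, sub_mul, Finset.sum_sub_distrib, sub_eq_zero] using h₁
  have hgroup' : ∀ (t : ℂ) (I₀ : Fin r → ℤ),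
      ∑ I ∈ S with key I = key I₀, a I * Complex.exp (L I 0) * t ^ ∑ i, I i * v i =
        (if key I₀ = φ₀ then Complex.exp (h 0) else 0) * t ^ ∑ i, I₀ i * v i := by
    intro t I₀
    rw [← hgroup, Finset.sum_mul]
    refine Finset.sum_congr rfl fun I hI => ?_
    rw [hdeg I I₀ (Finset.mem_filter.mp hI).2]
  obtain ⟨I₀, hI₀, hkey₀⟩ : ∃ I₀ ∈ S, key I₀ = φ₀ := by
    have h₁ := hgroup φ₀
    rw [if_pos rfl] at h₁
    obtain ⟨I₀, hI₀, -⟩ := Finset.exists_ne_zero_of_sum_ne_zero (h₁ ▸ Complex.exp_ne_zero (h 0))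
    exact ⟨I₀, Finset.mem_filter.mp hI₀⟩
  refine ⟨f 0, v, hf0 0, hv, ?_⟩
  rintro _ ⟨t, ht, rfl⟩
  refine ⟨fun i => mul_ne_zero (hf0 0 i) (zpow_ne_zero _ ht), fun hZ => ?_⟩
  have hZ₂ := hZ.2
  simp only [pa, lmon_mul_zpow _ ht, hlmon, ← mul_assoc] at hZ₂
  rw [← Finset.sum_fiberwise_of_maps_to (g := key) (t := S.image key)
    fun I hI => Finset.mem_image_of_mem _ hI, Finset.sum_eq_single (key I₀), hgroup',
    if_pos hkey₀] at hZ₂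
  · exact mul_ne_zero (Complex.exp_ne_zero _) (zpow_ne_zero _ ht) hZ₂
  · intro φ hφ hφne
    obtain ⟨I, -, rfl⟩ := Finset.mem_image.mp hφ
    rw [hgroup', if_neg fun h => hφne (h.trans hkey₀.symm), zero_mul]
  · exact fun h => absurd (Finset.mem_image_of_mem _ hI₀) h
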